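/- In the clipping ANN setting, assume that f is non-decreasing and satisfies Lip(f) < min_{i ∈ {1,…,h}} v_i w_i, let Θ ∈ C([0, ∞), ℝ^{h+1}) be a gradient flow trajectory, let ϑ ∈ ℝ^{h+1} satisfy limsup_{t→∞} ‖Θ_t − ϑ‖ = 0, let V = sup_{x ∈ (a,b)} Σ_{i ∈ {1,…,h}, x ∈ I_i^ϑ} v_i, assume V < [∫_a^b p(x) dx]^{−1} · min{ ∫_a^b (f(b) − f(x)) p(x) dx, ∫_a^b (f(x) − f(a)) p(x) dx }, and assume Σ_{i=1}^h v_i · 1_{(a − 1/w_i, b)}(ψ_i(Θ_0)) > f(b) − f(a) + 4V. Then L(ϑ) ≤ (2V² + (f(b) − f(a)) V) ∫_a^b p(x) dx. -/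

import Mathlib

open MeasureTheory Filter

noncomputable section

/-- The clipping function `x ↦ min{max{x,0},1}`. -/
def clipFn (x : ℝ) : ℝ := min (max x 0) 1

/-- `ψ_i(θ) = -θ_i / w_i`. -/
def psiC {h : ℕ} (w : Fin h → ℝ) (θ : Fin (h + 1) → ℝ) (i : Fin h) : ℝ :=
  -θ i.castSucc / w i

/-- The activity interval `I_i^θ = (ψ_i(θ), ψ_i(θ) + 1/w_i) ∩ (a, b)`. -/
def actI {h : ℕ} (a b : ℝ) (w : Fin h → ℝ) (θ : Fin (h + 1) → ℝ) (i : Fin h) : Set ℝ :=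
  Set.Ioo (psiC w θ i) (psiC w θ i + (w i)⁻¹) ∩ Set.Ioo a b

/-- The realization function `N^θ(x) = θ_{h+1} + ∑_i v_i c(w_i x + θ_i)`. -/
def realC {h : ℕ} (v w : Fin h → ℝ) (θ : Fin (h + 1) → ℝ) (x : ℝ) : ℝ :=
  θ (Fin.last h) + ∑ i : Fin h, v i * clipFn (w i * x + θ i.castSucc)

/-- The risk `L(θ) = ∫_a^b (N^θ(x) - f(x))² p(x) dx`. -/
def riskC {h : ℕ} (a b : ℝ) (v w : Fin h → ℝ) (f p : ℝ → ℝ) (θ : Fin (h + 1) → ℝ) : ℝ :=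
  ∫ x in Set.Ioo a b, (realC v w θ x - f x) ^ 2 * p x

/-- The gradient `∇L(θ)` as a vector of partial derivatives. -/
def gradC {h : ℕ} (a b : ℝ) (v w : Fin h → ℝ) (f p : ℝ → ℝ) (θ : Fin (h + 1) → ℝ) :
    Fin (h + 1) → ℝ :=
  fun k => fderiv ℝ (riskC a b v w f p) θ (Pi.single k 1)

/-- `x` is a descending critical point of `g` : `∇g(x) = 0` and the Hessian quadratic form
admits a negative value. -/
def IsDescCrit {n : ℕ} (g : (Fin n → ℝ) → ℝ) (x : Fin n → ℝ) : Prop :=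
  fderiv ℝ g x = 0 ∧ ∃ u : Fin n → ℝ, iteratedFDeriv ℝ 2 g x ![u, u] < 0

/-- The Euclidean norm on `Fin n → ℝ`. -/
def euclNorm {n : ℕ} (x : Fin n → ℝ) : ℝ := Real.sqrt (∑ i, (x i) ^ 2)

/-- Piecewise polynomial functions. -/
def PiecewisePoly (F : ℝ → ℝ) : Prop :=
  ∃ (K : ℕ) (τ : ℕ → EReal), 0 < K ∧ τ 0 = ⊥ ∧ τ K = ⊤ ∧
    (∀ k, k < K → τ k < τ (k + 1)) ∧
    ∀ k, k < K → ∃ q : Polynomial ℝ, ∀ x : ℝ,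
      τ k < (x : EReal) → (x : EReal) < τ (k + 1) → F x = q.eval x

lemma clipFn_mono : Monotone clipFn := fun _ _ hxy =>
  min_le_min_right _ (max_le_max_right _ hxy)

lemma clipFn_nonneg (x : ℝ) : 0 ≤ clipFn x := le_min (le_max_right _ _) zero_le_one

lemma clipFn_le_one (x : ℝ) : clipFn x ≤ 1 := min_le_right _ _

lemma clipFn_of_nonpos {x : ℝ} (hx : x ≤ 0) : clipFn x = 0 := by
  simp [clipFn, max_eq_right hx]

lemma clipFn_of_one_le {x : ℝ} (hx : 1 ≤ x) : clipFn x = 1 := by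
  simp [clipFn, hx]

lemma clipFn_of_mem {x : ℝ} (h0 : 0 ≤ x) (h1 : x ≤ 1) : clipFn x = x := by
  simp [clipFn, max_eq_left h0, h1]

lemma continuous_clipFn : Continuous clipFn := by
  unfold clipFn
  fun_prop

lemma abs_clipFn_sub_le (x y : ℝ) : |clipFn x - clipFn y| ≤ |x - y| :=
  (abs_min_sub_min_le_max _ _ _ _).trans <| by
    simpa using (abs_max_sub_max_le_max x 0 y 0)

/-- The weak derivative of the clipping function. -/
def clipDeriv (x : ℝ) : ℝ := (Set.Ioo (0 : ℝ) 1).indicator 1 x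

lemma clipDeriv_nonneg (x : ℝ) : 0 ≤ clipDeriv x :=
  Set.indicator_nonneg (fun _ _ => zero_le_one) x

lemma clipDeriv_le_one (x : ℝ) : clipDeriv x ≤ 1 :=
  Set.indicator_le_self' (fun _ _ => zero_le_one) x

lemma measurable_clipDeriv : Measurable clipDeriv :=
  measurable_one.indicator measurableSet_Ioo

lemma clipDeriv_eventually_const {x : ℝ} (h0 : x ≠ 0) (h1 : x ≠ 1) :
    ∀ᶠ y in nhds x, clipDeriv y = clipDeriv x := by
  rcases lt_or_gt_of_ne h0 with h | h
  · filter_upwards [Iio_mem_nhds h] with y hy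
    simp only [Set.mem_Iio] at hy
    simp [clipDeriv, Set.indicator, not_lt.2 hy.le, not_lt.2 h.le]
  rcases lt_or_gt_of_ne h1 with h' | h'
  · filter_upwards [Ioo_mem_nhds h h'] with y hy
    simp [clipDeriv, Set.indicator, hy.1, hy.2, h, h']
  · filter_upwards [Ioi_mem_nhds h'] with y hy
    simp only [Set.mem_Ioi] at hy
    simp [clipDeriv, Set.indicator, not_lt.2 hy.le, not_lt.2 h'.le]

lemma hasDerivAt_clipFn {x : ℝ} (h0 : x ≠ 0) (h1 : x ≠ 1) :
    HasDerivAt clipFn (clipDeriv x) x := by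
  rcases lt_or_gt_of_ne h0 with h | h
  · have : clipDeriv x = 0 := by simp [clipDeriv, Set.indicator, not_lt.2 h.le]
    rw [this]
    refine (hasDerivAt_const x (0 : ℝ)).congr_of_eventuallyEq ?_
    filter_upwards [Iio_mem_nhds h] with y hy using clipFn_of_nonpos (le_of_lt hy)
  rcases lt_or_gt_of_ne h1 with h' | h'
  · have : clipDeriv x = 1 := by simp [clipDeriv, Set.indicator, h, h']
    rw [this]
    refine (hasDerivAt_id x).congr_of_eventuallyEq ?_
    filter_upwards [Ioo_mem_nhds h h'] with y hy using clipFn_of_mem hy.1.le hy.2.le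
  · have : clipDeriv x = 0 := by simp [clipDeriv, Set.indicator, not_lt.2 h'.le]
    rw [this]
    refine (hasDerivAt_const x (1 : ℝ)).congr_of_eventuallyEq ?_
    filter_upwards [Ioi_mem_nhds h'] with y hy using clipFn_of_one_le (le_of_lt hy)

section Calculus

variable {h : ℕ} {v w : Fin h → ℝ}

lemma mem_actI_iff {a b : ℝ} (hw : ∀ i, 0 < w i) {θ : Fin (h + 1) → ℝ} {i : Fin h} {x : ℝ} :
    x ∈ actI a b w θ i ↔
      (0 < w i * x + θ i.castSucc ∧ w i * x + θ i.castSucc < 1) ∧ a < x ∧ x < b := by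
  have hi := hw i
  have e1 : -θ i.castSucc / w i < x ↔ 0 < w i * x + θ i.castSucc := by
    rw [div_lt_iff₀ hi]; constructor <;> intro <;> linarith
  have e2 : x < -θ i.castSucc / w i + (w i)⁻¹ ↔ w i * x + θ i.castSucc < 1 := by
    rw [← one_div, ← add_div, lt_div_iff₀ hi]; constructor <;> intro <;> linarith
  simp only [actI, psiC, Set.mem_inter_iff, Set.mem_Ioo, e1, e2]

lemma continuous_realC : Continuous fun q : (Fin (h + 1) → ℝ) × ℝ => realC v w q.1 q.2 := by
  unfold realC
  have := continuous_clipFn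
  fun_prop

lemma continuous_realC_right (θ : Fin (h + 1) → ℝ) : Continuous (realC v w θ) :=
  continuous_realC.comp (Continuous.prodMk_right θ)

lemma abs_realC_sub_le (hv : ∀ i, 0 < v i) (θ η : Fin (h + 1) → ℝ) (x : ℝ) :
    |realC v w θ x - realC v w η x| ≤ (1 + ∑ i, v i) * ‖θ - η‖ := by
  have hk : ∀ k, |θ k - η k| ≤ ‖θ - η‖ := fun k => by
    simpa using norm_le_pi_norm (θ - η) k
  have : realC v w θ x - realC v w η x = (θ (Fin.last h) - η (Fin.last h)) +
      ∑ i, v i * (clipFn (w i * x + θ i.castSucc) - clipFn (w i * x + η i.castSucc)) := by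
    simp only [realC, mul_sub, Finset.sum_sub_distrib]; ring
  rw [this, add_mul, one_mul, Finset.sum_mul]
  refine (abs_add_le _ _).trans (add_le_add (hk _) ?_)
  refine (Finset.abs_sum_le_sum_abs _ _).trans (Finset.sum_le_sum fun i _ => ?_)
  rw [abs_mul, abs_of_pos (hv i)]
  refine mul_le_mul_of_nonneg_left ((abs_clipFn_sub_le _ _).trans ?_) (hv i).le
  simpa using hk i.castSucc

/-- The derivative of `θ ↦ N^θ(x)` away from the kinks. -/
def realD (v w : Fin h → ℝ) (θ : Fin (h + 1) → ℝ) (x : ℝ) : (Fin (h + 1) → ℝ) →L[ℝ] ℝ :=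
  ContinuousLinearMap.proj (Fin.last h) +
    ∑ i : Fin h, (v i * clipDeriv (w i * x + θ i.castSucc)) •
      (ContinuousLinearMap.proj i.castSucc : (Fin (h + 1) → ℝ) →L[ℝ] ℝ)

lemma hasFDerivAt_realC {θ : Fin (h + 1) → ℝ} {x : ℝ}
    (hx : ∀ i : Fin h, w i * x + θ i.castSucc ≠ 0 ∧ w i * x + θ i.castSucc ≠ 1) :
    HasFDerivAt (fun η => realC v w η x) (realD v w θ x) θ := by
  unfold realC realD
  refine HasFDerivAt.add
    (ContinuousLinearMap.proj (R := ℝ) (φ := fun _ : Fin (h + 1) => ℝ) (Fin.last h)).hasFDerivAt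
    (HasFDerivAt.fun_sum fun i _ => ?_)
  have h1 : HasFDerivAt (fun η : Fin (h + 1) → ℝ => w i * x + η i.castSucc)
      (ContinuousLinearMap.proj i.castSucc : (Fin (h + 1) → ℝ) →L[ℝ] ℝ) θ :=
    ((ContinuousLinearMap.proj (R := ℝ) (φ := fun _ : Fin (h + 1) => ℝ)
      i.castSucc).hasFDerivAt).const_add _
  have h2 := ((hasDerivAt_clipFn (hx i).1 (hx i).2).comp_hasFDerivAt θ h1).const_mul (v i)
  simpa [smul_smul, Function.comp_def] using h2

lemma ae_ne_kink (hw : ∀ i, 0 < w i) (θ : Fin (h + 1) → ℝ) (s : Set ℝ) :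
    ∀ᵐ x ∂(volume.restrict s),
      ∀ i : Fin h, w i * x + θ i.castSucc ≠ 0 ∧ w i * x + θ i.castSucc ≠ 1 := by
  refine ae_restrict_of_ae (ae_all_iff.2 fun i => ?_)
  have hi := (hw i).ne'
  filter_upwards [(Set.finite_singleton (-θ i.castSucc / w i)).measure_zero volume |>
    compl_mem_ae_iff.2, (Set.finite_singleton ((1 - θ i.castSucc) / w i)).measure_zero volume |>
    compl_mem_ae_iff.2] with x h1 h2
  simp only [Set.mem_compl_iff, Set.mem_singleton_iff, eq_div_iff hi] at h1 h2
  exact ⟨fun h' => h1 (by linarith), fun h' => h2 (by linarith)⟩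

lemma integrableOn_Ioo_of_continuous {g : ℝ → ℝ} (hg : Continuous g) (a b : ℝ) :
    IntegrableOn g (Set.Ioo a b) :=
  (hg.integrableOn_Icc).mono_set Set.Ioo_subset_Icc_self

lemma measurable_clipDeriv_affine (c d : ℝ) : Measurable fun x : ℝ => clipDeriv (c * x + d) :=
  measurable_clipDeriv.comp (by fun_prop)

lemma hasFDerivAt_riskC (hv : ∀ i, 0 < v i) (hw : ∀ i, 0 < w i) {f p : ℝ → ℝ}
    (hf : Continuous f) (hp : Continuous p) (a b : ℝ) (θ : Fin (h + 1) → ℝ) :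
    Integrable (fun x => (2 * (realC v w θ x - f x) * p x) • realD v w θ x)
      (volume.restrict (Set.Ioo a b)) ∧
    HasFDerivAt (riskC a b v w f p)
      (∫ x in Set.Ioo a b, (2 * (realC v w θ x - f x) * p x) • realD v w θ x) θ := by
  have hN := fun η : Fin (h + 1) → ℝ => continuous_realC_right (v := v) (w := w) η
  set S := 1 + ∑ i, v i with hS
  have hS0 : 0 ≤ S := add_nonneg zero_le_one (Finset.sum_nonneg fun i _ => (hv i).le)
  refine hasFDerivAt_integral_of_dominated_loc_of_lip'
    (bound := fun x => S * (2 * |realC v w θ x - f x| + S) * |p x|)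
    (Metric.ball_mem_nhds θ one_pos) (fun η _ => ?_) ?_ ?_ ?_ ?_ ?_
  · have := hN η
    exact (by fun_prop : Continuous fun x => (realC v w η x - f x) ^ 2 * p x).aestronglyMeasurable
  · have := hN θ
    exact integrableOn_Ioo_of_continuous (by fun_prop) a b
  · have := hN θ
    refine ((by fun_prop : Continuous fun x =>
      2 * (realC v w θ x - f x) * p x).aestronglyMeasurable).smul ?_
    refine aestronglyMeasurable_const.add ?_
    refine Finset.aestronglyMeasurable_fun_sum _ fun i _ => ?_
    exact (((measurable_clipDeriv_affine (w i) (θ i.castSucc)).const_mul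
      (v i)).aestronglyMeasurable).smul_const _
  · refine Eventually.of_forall fun x η hη => ?_
    have h1 := abs_realC_sub_le (w := w) hv η θ x
    have hd : ‖η - θ‖ ≤ 1 := by
      rw [← dist_eq_norm]; exact (Metric.mem_ball.1 hη).le
    have e : (realC v w η x - f x) ^ 2 * p x - (realC v w θ x - f x) ^ 2 * p x =
        (realC v w η x - realC v w θ x) *
          (2 * (realC v w θ x - f x) + (realC v w η x - realC v w θ x)) * p x := by ring
    rw [Real.norm_eq_abs, e, abs_mul, abs_mul]
    have h2 : |2 * (realC v w θ x - f x) + (realC v w η x - realC v w θ x)| ≤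
        2 * |realC v w θ x - f x| + S := by
      refine (abs_add_le _ _).trans (add_le_add ?_ (h1.trans ?_))
      · rw [abs_mul, abs_two]
      · exact mul_le_of_le_one_right hS0 hd
    calc _ ≤ S * ‖η - θ‖ * (2 * |realC v w θ x - f x| + S) * |p x| := by gcongr
      _ = _ := by ring
  · have := hN θ
    exact integrableOn_Ioo_of_continuous (by fun_prop) a b
  · filter_upwards [ae_ne_kink hw θ (Set.Ioo a b)] with x hx
    have h1 := ((hasFDerivAt_realC (v := v) hx).sub_const (f x)).pow 2 |>.mul_const (p x)
    refine h1.congr_fderiv ?_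
    ext u
    simp
    ring

lemma realD_last (θ : Fin (h + 1) → ℝ) (x : ℝ) :
    realD v w θ x (Pi.single (Fin.last h) 1) = 1 := by
  simp [realD]

lemma realD_castSucc (θ : Fin (h + 1) → ℝ) (x : ℝ) (i : Fin h) :
    realD v w θ x (Pi.single i.castSucc 1) = v i * clipDeriv (w i * x + θ i.castSucc) := by
  simp [realD, Pi.single_apply]

lemma gradC_eq_integral (hv : ∀ i, 0 < v i) (hw : ∀ i, 0 < w i) {f p : ℝ → ℝ}
    (hf : Continuous f) (hp : Continuous p) (a b : ℝ) (θ : Fin (h + 1) → ℝ) (k : Fin (h + 1)) :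
    gradC a b v w f p θ k = ∫ x in Set.Ioo a b,
      2 * (realC v w θ x - f x) * p x * realD v w θ x (Pi.single k 1) := by
  obtain ⟨hi, hd⟩ := hasFDerivAt_riskC hv hw hf hp a b θ
  rw [gradC, hd.fderiv, ContinuousLinearMap.integral_apply hi]
  rfl

lemma gradC_last (hv : ∀ i, 0 < v i) (hw : ∀ i, 0 < w i) {f p : ℝ → ℝ}
    (hf : Continuous f) (hp : Continuous p) (a b : ℝ) (θ : Fin (h + 1) → ℝ) :
    gradC a b v w f p θ (Fin.last h) =
      2 * ∫ x in Set.Ioo a b, (realC v w θ x - f x) * p x := by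
  rw [gradC_eq_integral hv hw hf hp, ← integral_const_mul]
  simp [realD_last, mul_assoc]

lemma gradC_castSucc (hv : ∀ i, 0 < v i) (hw : ∀ i, 0 < w i) {f p : ℝ → ℝ}
    (hf : Continuous f) (hp : Continuous p) (a b : ℝ) (θ : Fin (h + 1) → ℝ) (i : Fin h) :
    gradC a b v w f p θ i.castSucc =
      2 * v i * ∫ x in actI a b w θ i, (realC v w θ x - f x) * p x := by
  have hsub : actI a b w θ i ⊆ Set.Ioo a b := Set.inter_subset_right
  have hm : MeasurableSet (actI a b w θ i) := measurableSet_Ioo.inter measurableSet_Ioo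
  rw [gradC_eq_integral hv hw hf hp, ← integral_const_mul,
    setIntegral_eq_of_subset_of_forall_sdiff_eq_zero measurableSet_Ioo hsub]
  · refine setIntegral_congr_fun hm fun x hx => ?_
    have := (mem_actI_iff hw).1 hx
    simp only [realD_castSucc, clipDeriv, Set.indicator_of_mem (Set.mem_Ioo.2 this.1),
      Pi.one_apply]
    ring
  · intro x hx
    have : w i * x + θ i.castSucc ∉ Set.Ioo (0 : ℝ) 1 := fun h' =>
      hx.2 ((mem_actI_iff hw).2 ⟨h', hx.1⟩)
    simp [realD_castSucc, clipDeriv, Set.indicator_of_notMem this]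

lemma abs_realD_single_le (hv : ∀ i, 0 < v i) (θ : Fin (h + 1) → ℝ) (x : ℝ) (k : Fin (h + 1)) :
    |realD v w θ x (Pi.single k 1)| ≤ 1 + ∑ i, v i := by
  have hs : 0 ≤ ∑ i, v i := Finset.sum_nonneg fun i _ => (hv i).le
  refine Fin.lastCases ?_ (fun i => ?_) k
  · rw [realD_last, abs_one]; linarith
  · rw [realD_castSucc, abs_of_nonneg (mul_nonneg (hv i).le (clipDeriv_nonneg _))]
    have h1 := Finset.single_le_sum (fun j _ => (hv j).le) (Finset.mem_univ i)
    have h2 := mul_le_of_le_one_right (hv i).le (clipDeriv_le_one (w i * x + θ i.castSucc))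
    linarith

lemma continuous_gradC (hv : ∀ i, 0 < v i) (hw : ∀ i, 0 < w i) {f p : ℝ → ℝ}
    (hf : Continuous f) (hp : Continuous p) (a b : ℝ) :
    Continuous (gradC a b v w f p) := by
  refine continuous_pi fun k => ?_
  simp only [gradC_eq_integral hv hw hf hp]
  refine continuous_iff_continuousAt.2 fun θ => ?_
  have hN := fun η : Fin (h + 1) → ℝ => continuous_realC_right (v := v) (w := w) η
  have hNθ := hN θ
  set S := 1 + ∑ i, v i with hS
  have hS0 : 0 ≤ S := add_nonneg zero_le_one (Finset.sum_nonneg fun i _ => (hv i).le)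
  refine MeasureTheory.continuousAt_of_dominated
    (bound := fun x => 2 * (|realC v w θ x - f x| + S) * |p x| * S) ?_ ?_ ?_ ?_
  · refine Eventually.of_forall fun η => ?_
    have := hN η
    refine ((by fun_prop : Continuous fun x =>
      2 * (realC v w η x - f x) * p x).aestronglyMeasurable).mul ?_
    refine Fin.lastCases ?_ (fun i => ?_) k
    · simp only [realD_last]; exact aestronglyMeasurable_const
    · simp only [realD_castSucc]
      exact ((measurable_clipDeriv_affine (w i) (η i.castSucc)).const_mul
        (v i)).aestronglyMeasurable
  · filter_upwards [Metric.ball_mem_nhds θ one_pos] with η hη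
    refine Eventually.of_forall fun x => ?_
    have h1 := abs_realC_sub_le (w := w) hv η θ x
    have hd : ‖η - θ‖ ≤ 1 := by
      rw [← dist_eq_norm]; exact (Metric.mem_ball.1 hη).le
    have h2 : |realC v w η x - f x| ≤ |realC v w θ x - f x| + S := by
      have : realC v w η x - f x = (realC v w θ x - f x) + (realC v w η x - realC v w θ x) := by
        ring
      rw [this]
      exact (abs_add_le _ _).trans
        (add_le_add le_rfl (h1.trans (mul_le_of_le_one_right hS0 hd)))
    rw [Real.norm_eq_abs, abs_mul, abs_mul, abs_mul, abs_two]
    have h3 := abs_realD_single_le (w := w) hv η x k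
    gcongr
  · exact integrableOn_Ioo_of_continuous (by fun_prop) a b
  · filter_upwards [ae_ne_kink hw θ (Set.Ioo a b)] with x hx
    refine ContinuousAt.mul ?_ ?_
    · have : Continuous fun η : Fin (h + 1) → ℝ => realC v w η x :=
        continuous_realC.comp (Continuous.prodMk_left x)
      fun_prop
    · refine Fin.lastCases ?_ (fun i => ?_) k
      · simp only [realD_last]; exact continuousAt_const
      · simp only [realD_castSucc]
        refine continuousAt_const.mul ?_
        have hc : ContinuousAt (fun η : Fin (h + 1) → ℝ => w i * x + η i.castSucc) θ :=
          continuousAt_const.add (continuous_apply i.castSucc).continuousAt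
        refine (tendsto_const_nhds.congr' ?_ : Tendsto _ _ (nhds (clipDeriv
          (w i * x + θ i.castSucc))))
        filter_upwards [hc.eventually (clipDeriv_eventually_const (hx i).1 (hx i).2)] with η hη
          using hη.symm

end Calculus

section Structure

variable {h : ℕ} {v w : Fin h → ℝ}

lemma exists_eq_zero_of_setIntegral_mul_eq_zero {g p : ℝ → ℝ} {s : Set ℝ} (hg : Continuous g)
    (hs : IsOpen s) (hsc : s.OrdConnected) (hne : s.Nonempty) (hp : ∀ x ∈ s, 0 < p x)
    (hInt : IntegrableOn (fun x => g x * p x) s) (h0 : ∫ x in s, g x * p x = 0) :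
    ∃ z ∈ s, g z = 0 := by
  by_contra! hcon
  have hpos : ∀ q : ℝ → ℝ, IntegrableOn (fun x => q x * p x) s → (∀ x ∈ s, 0 < q x) →
      0 < ∫ x in s, q x * p x := fun q hq hq0 => by
    rw [setIntegral_pos_iff_support_of_nonneg_ae _ hq]
    · have : s ⊆ Function.support (fun x => q x * p x) := fun x hx =>
        (mul_pos (hq0 x hx) (hp x hx)).ne'
      rw [Set.inter_eq_right.2 this]
      exact hs.measure_pos volume hne
    · filter_upwards [ae_restrict_mem hs.measurableSet] with x hx
      exact (mul_pos (hq0 x hx) (hp x hx)).le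
  obtain ⟨z, hz⟩ := hne
  have hpc : IsPreconnected s := hsc.isPreconnected
  rcases lt_or_gt_of_ne (hcon z hz) with hz0 | hz0
  · have : ∀ x ∈ s, 0 < -g x := fun x hx => by
      by_contra! hx0
      obtain ⟨y, hy, hy0⟩ := hpc.intermediate_value hz hx hg.continuousOn
        (show (0 : ℝ) ∈ Set.Icc (g z) (g x) from ⟨hz0.le, by linarith⟩)
      exact hcon y hy hy0
    have h1 := hpos (fun x => -g x) (by simpa using hInt.neg) this
    simp only [neg_mul, integral_neg, h0, neg_zero, lt_self_iff_false] at h1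
  · have : ∀ x ∈ s, 0 < g x := fun x hx => by
      by_contra! hx0
      obtain ⟨y, hy, hy0⟩ := hpc.intermediate_value hx hz hg.continuousOn
        (show (0 : ℝ) ∈ Set.Icc (g x) (g z) from ⟨hx0, hz0.le⟩)
      exact hcon y hy hy0
    exact (hpos g hInt this).ne' h0

lemma ordConnected_actI (a b : ℝ) (w : Fin h → ℝ) (θ : Fin (h + 1) → ℝ) (i : Fin h) :
    (actI a b w θ i).OrdConnected :=
  Set.ordConnected_Ioo.inter Set.ordConnected_Ioo

lemma isOpen_actI (a b : ℝ) (w : Fin h → ℝ) (θ : Fin (h + 1) → ℝ) (i : Fin h) :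
    IsOpen (actI a b w θ i) :=
  isOpen_Ioo.inter isOpen_Ioo

lemma realC_sub_eq_sum (θ : Fin (h + 1) → ℝ) (x y : ℝ) :
    realC v w θ y - realC v w θ x =
      ∑ i, v i * (clipFn (w i * y + θ i.castSucc) - clipFn (w i * x + θ i.castSucc)) := by
  simp only [realC, mul_sub, Finset.sum_sub_distrib]; ring

lemma clipFn_affine_mono (hw : ∀ i, 0 < w i) (θ : Fin (h + 1) → ℝ) (i : Fin h) {x y : ℝ}
    (hxy : x ≤ y) : clipFn (w i * x + θ i.castSucc) ≤ clipFn (w i * y + θ i.castSucc) :=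
  clipFn_mono (by have := mul_le_mul_of_nonneg_left hxy (hw i).le; linarith)

lemma realC_mono (hv : ∀ i, 0 < v i) (hw : ∀ i, 0 < w i) (θ : Fin (h + 1) → ℝ) :
    Monotone (realC v w θ) := fun x y hxy => by
  rw [← sub_nonneg, realC_sub_eq_sum]
  exact Finset.sum_nonneg fun i _ =>
    mul_nonneg (hv i).le (sub_nonneg.2 (clipFn_affine_mono hw θ i hxy))

/-- A neuron that changes its value between `x` and `y` is active strictly in between. -/
lemma exists_mem_actI_of_clipFn_ne {a b : ℝ} (hw : ∀ i, 0 < w i) {θ : Fin (h + 1) → ℝ} {i : Fin h}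
    {x y : ℝ} (hax : a ≤ x) (hxy : x ≤ y) (hyb : y ≤ b)
    (hne : clipFn (w i * y + θ i.castSucc) ≠ clipFn (w i * x + θ i.castSucc)) :
    ∃ m ∈ actI a b w θ i, x < m ∧ m < y := by
  have hi := hw i
  set X := w i * x + θ i.castSucc with hX
  set Y := w i * y + θ i.castSucc with hY
  have hXY : X ≤ Y := by
    have := mul_le_mul_of_nonneg_left hxy hi.le
    linarith
  have hX1 : X < 1 := by
    by_contra! h1
    exact hne (by rw [clipFn_of_one_le h1, clipFn_of_one_le (h1.trans hXY)])
  have hY0 : 0 < Y := by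
    by_contra! h1
    exact hne (by rw [clipFn_of_nonpos h1, clipFn_of_nonpos (hXY.trans h1)])
  have hlt : X < Y := lt_of_le_of_ne hXY fun h' => hne (by rw [h'])
  obtain ⟨M, hM1, hM2⟩ := exists_between
    (max_lt (lt_min hlt hX1) (lt_min hY0 zero_lt_one) : max X 0 < min Y 1)
  have hMm : w i * ((M - θ i.castSucc) / w i) + θ i.castSucc = M := by field_simp; ring
  have hm1 : x < (M - θ i.castSucc) / w i := by
    rw [lt_div_iff₀ hi]; linarith [(le_max_left X 0).trans_lt hM1]
  have hm2 : (M - θ i.castSucc) / w i < y := by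
    rw [div_lt_iff₀ hi]; linarith [hM2.trans_le (min_le_left Y 1)]
  refine ⟨(M - θ i.castSucc) / w i, (mem_actI_iff hw).2 ⟨?_, by linarith, by linarith⟩, hm1, hm2⟩
  rw [hMm]
  exact ⟨(le_max_right X 0).trans_lt hM1, hM2.trans_le (min_le_right Y 1)⟩

/-- On an activity interval the realization function grows faster than the target. -/
lemma sub_lt_realC_sub {a b : ℝ} (hv : ∀ i, 0 < v i) (hw : ∀ i, 0 < w i) {f : ℝ → ℝ} {K : ℝ}
    (hK : ∀ i, K < v i * w i)
    (hLip : ∀ x ∈ Set.Icc a b, ∀ y ∈ Set.Icc a b, |f x - f y| ≤ K * |x - y|)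
    {θ : Fin (h + 1) → ℝ} {i : Fin h} {x y : ℝ} (hx : x ∈ actI a b w θ i)
    (hy : y ∈ actI a b w θ i) (hxy : x < y) :
    f y - f x < realC v w θ y - realC v w θ x := by
  obtain ⟨⟨x0, x1⟩, xa, xb⟩ := (mem_actI_iff hw).1 hx
  obtain ⟨⟨y0, y1⟩, ya, yb⟩ := (mem_actI_iff hw).1 hy
  have h1 := (le_abs_self _).trans (hLip y ⟨ya.le, yb.le⟩ x ⟨xa.le, xb.le⟩)
  rw [abs_of_pos (sub_pos.2 hxy)] at h1
  have h2 : K * (y - x) < v i * w i * (y - x) := mul_lt_mul_of_pos_right (hK i) (sub_pos.2 hxy)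
  have h3 := Finset.single_le_sum
    (f := fun j => v j * (clipFn (w j * y + θ j.castSucc) - clipFn (w j * x + θ j.castSucc)))
    (fun j _ => mul_nonneg (hv j).le (sub_nonneg.2 (clipFn_affine_mono hw θ j hxy.le)))
    (Finset.mem_univ i)
  rw [← realC_sub_eq_sum] at h3
  simp only [clipFn_of_mem x0.le x1.le, clipFn_of_mem y0.le y1.le] at h3
  linarith

/-- The variation of the realization function is controlled by the neurons active at `z` as soon
as all neurons that vary between `x` and `y` are active at `z`. -/
lemma realC_sub_le_sum_indicator {a b : ℝ} (hv : ∀ i, 0 < v i) (hw : ∀ i, 0 < w i)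
    {θ : Fin (h + 1) → ℝ} {x y z : ℝ} (hax : a ≤ x) (hxy : x ≤ y) (hyb : y ≤ b)
    (hz : ∀ i, ∀ m ∈ actI a b w θ i, x < m → m < y → z ∈ actI a b w θ i) :
    realC v w θ y - realC v w θ x ≤
      ∑ i : Fin h, (actI a b w θ i).indicator (fun _ => v i) z := by
  rw [realC_sub_eq_sum]
  refine Finset.sum_le_sum fun i _ => ?_
  by_cases hne : clipFn (w i * y + θ i.castSucc) = clipFn (w i * x + θ i.castSucc)
  · rw [hne, sub_self, mul_zero]
    exact Set.indicator_nonneg (fun _ _ => (hv i).le) z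
  · obtain ⟨m, hm, hxm, hmy⟩ := exists_mem_actI_of_clipFn_ne hw hax hxy hyb hne
    rw [Set.indicator_of_mem (hz i m hm hxm hmy)]
    refine mul_le_of_le_one_right (hv i).le ?_
    linarith [clipFn_le_one (w i * y + θ i.castSucc), clipFn_nonneg (w i * x + θ i.castSucc)]

lemma realC_eq_of_forall_notMem_actI {a b : ℝ} (hw : ∀ i, 0 < w i) {θ : Fin (h + 1) → ℝ} {x y : ℝ}
    (hax : a ≤ x) (hxy : x ≤ y) (hyb : y ≤ b)
    (hno : ∀ i, ∀ m ∈ actI a b w θ i, x < m → m < y → False) :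
    realC v w θ y = realC v w θ x := by
  rw [← sub_eq_zero, realC_sub_eq_sum]
  refine Finset.sum_eq_zero fun i _ => ?_
  by_cases hne : clipFn (w i * y + θ i.castSucc) = clipFn (w i * x + θ i.castSucc)
  · rw [hne, sub_self, mul_zero]
  · obtain ⟨m, hm, hxm, hmy⟩ := exists_mem_actI_of_clipFn_ne hw hax hxy hyb hne
    exact (hno i m hm hxm hmy).elim

open Classical in
/-- At a critical point with sufficiently many active neurons the error is bounded by `V` from at
least one side, and by `V + (f(b) - f(a))` from the other side. -/
lemma realC_sub_bounds_of_critical {a b : ℝ} (hv : ∀ i, 0 < v i)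
    (hw : ∀ i, 0 < w i) {f : ℝ → ℝ} (hfmono : Monotone f) {K : ℝ} (hK : ∀ i, K < v i * w i)
    (hLip : ∀ x ∈ Set.Icc a b, ∀ y ∈ Set.Icc a b, |f x - f y| ≤ K * |x - y|)
    {θ : Fin (h + 1) → ℝ} {V : ℝ} (hV0 : 0 ≤ V)
    (hV : ∀ x ∈ Set.Ioo a b, ∑ i : Fin h, (actI a b w θ i).indicator (fun _ => v i) x ≤ V)
    (hzero : ∃ z ∈ Set.Ioo a b, realC v w θ z = f z)
    (hzeros : ∀ i, (actI a b w θ i).Nonempty → ∃ z ∈ actI a b w θ i, realC v w θ z = f z)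
    (hlive : realC v w θ b < f b → f a < realC v w θ a →
      f b - f a < ∑ i, if (actI a b w θ i).Nonempty then v i else 0) :
    (∀ x ∈ Set.Ioo a b, -V ≤ realC v w θ x - f x ∧ realC v w θ x - f x ≤ V + (f b - f a)) ∨
    (∀ x ∈ Set.Ioo a b, -(V + (f b - f a)) ≤ realC v w θ x - f x ∧ realC v w θ x - f x ≤ V) := by
  set N := realC v w θ with hN
  set I := actI a b w θ with hI
  have hmono : Monotone N := realC_mono hv hw θ
  have hIab : ∀ i, ∀ m ∈ I i, a < m ∧ m < b := fun i m hm => hm.2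
  have hord : ∀ i, ∀ x ∈ I i, ∀ y ∈ I i, ∀ z, x ≤ z → z ≤ y → z ∈ I i := fun i x hx y hy z h1 h2 =>
    (ordConnected_actI a b w θ i).out hx hy ⟨h1, h2⟩
  have hstrict : ∀ i, ∀ x ∈ I i, ∀ y ∈ I i, x < y → f y - f x < N y - N x :=
    fun i x hx y hy hxy => sub_lt_realC_sub hv hw hK hLip hx hy hxy
  have hex : ∀ i, ∃ z, (I i).Nonempty → z ∈ I i ∧ N z = f z := fun i => by
    by_cases hne : (I i).Nonempty
    · obtain ⟨z, hz⟩ := hzeros i hne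
      exact ⟨z, fun _ => hz⟩
    · exact ⟨0, fun h' => (hne h').elim⟩
  choose ζ hζ using hex
  have upper : ∀ x ∈ Set.Ioo a b, ∀ j, (I j).Nonempty → ζ j ≤ x → N x - f x ≤ V := by
    intro x hx j hj hjx
    obtain ⟨k, hk, hkmax⟩ := Finset.exists_max_image
      (Finset.univ.filter fun i => (I i).Nonempty ∧ ζ i ≤ x) ζ ⟨j, by simp [hj, hjx]⟩
    simp only [Finset.mem_filter, Finset.mem_univ, true_and] at hk hkmax
    obtain ⟨hkI, hkz⟩ := hζ k hk.1
    by_cases hle : N x ≤ f x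
    · linarith
    have h1 := realC_sub_le_sum_indicator (z := ζ k) hv hw (hIab k _ hkI).1.le hk.2 hx.2.le
      (θ := θ) fun i m hm h1 h2 => by
        obtain ⟨hiI, hiz⟩ := hζ i ⟨m, hm⟩
        rcases le_or_gt (ζ i) x with h3 | h3
        · exact hord i _ hiI _ hm _ (hkmax i ⟨⟨m, hm⟩, h3⟩) h1.le
        · have := hstrict i x (hord i _ hm _ hiI _ h2.le h3.le) _ hiI h3
          exact absurd (by linarith) hle
    have h2 := hV (ζ k) (hIab k _ hkI)
    have h3 := hfmono hk.2
    linarith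
  have lower : ∀ x ∈ Set.Ioo a b, ∀ j, (I j).Nonempty → x ≤ ζ j → -V ≤ N x - f x := by
    intro x hx j hj hjx
    obtain ⟨k, hk, hkmin⟩ := Finset.exists_min_image
      (Finset.univ.filter fun i => (I i).Nonempty ∧ x ≤ ζ i) ζ ⟨j, by simp [hj, hjx]⟩
    simp only [Finset.mem_filter, Finset.mem_univ, true_and] at hk hkmin
    obtain ⟨hkI, hkz⟩ := hζ k hk.1
    by_cases hle : f x ≤ N x
    · linarith
    have h1 := realC_sub_le_sum_indicator (z := ζ k) hv hw hx.1.le hk.2 (hIab k _ hkI).2.le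
      (θ := θ) fun i m hm h1 h2 => by
        obtain ⟨hiI, hiz⟩ := hζ i ⟨m, hm⟩
        rcases le_or_gt x (ζ i) with h3 | h3
        · exact hord i _ hm _ hiI _ h2.le (hkmin i ⟨⟨m, hm⟩, h3⟩)
        · have := hstrict i _ hiI x (hord i _ hiI _ hm _ h3.le h1.le) h3
          exact absurd (by linarith) hle
    have h2 := hV (ζ k) (hIab k _ hkI)
    have h3 := hfmono hk.2
    linarith
  obtain ⟨z₀, hz₀, hz₀f⟩ := hzero
  have hD : f a ≤ f b := hfmono (hz₀.1.trans hz₀.2).le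
  have upper' : ∀ x ∈ Set.Ioo a b, N x - f x ≤ V + (f b - f a) := fun x hx => by
    have hxa := hfmono hx.1.le
    by_cases hact : ∃ j, (I j).Nonempty
    · obtain ⟨j, hj⟩ := hact
      obtain ⟨hjI, hjz⟩ := hζ j hj
      rcases le_or_gt (ζ j) x with h1 | h1
      · linarith [upper x hx j hj h1]
      · linarith [hmono h1.le, hfmono (hIab j _ hjI).2.le]
    · have hc : N b = N a := realC_eq_of_forall_notMem_actI hw le_rfl (hz₀.1.trans hz₀.2).le le_rfl
        fun i m hm _ _ => hact ⟨i, m, hm⟩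
      linarith [hmono hx.2.le, hmono hz₀.1.le, hfmono hz₀.2.le]
  have lower' : ∀ x ∈ Set.Ioo a b, -(V + (f b - f a)) ≤ N x - f x := fun x hx => by
    have hxb := hfmono hx.2.le
    by_cases hact : ∃ j, (I j).Nonempty
    · obtain ⟨j, hj⟩ := hact
      obtain ⟨hjI, hjz⟩ := hζ j hj
      rcases le_or_gt x (ζ j) with h1 | h1
      · linarith [lower x hx j hj h1]
      · linarith [hmono h1.le, hfmono (hIab j _ hjI).1.le]
    · have hc : N b = N a := realC_eq_of_forall_notMem_actI hw le_rfl (hz₀.1.trans hz₀.2).le le_rfl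
        fun i m hm _ _ => hact ⟨i, m, hm⟩
      linarith [hmono hx.1.le, hmono hz₀.2.le, hfmono hz₀.1.le]
  by_contra! hcon
  obtain ⟨⟨y, hy, hy'⟩, ⟨x, hx, hx'⟩⟩ := hcon
  have hyV : N y - f y < -V := by
    by_contra! h1
    exact absurd (hy' h1) (not_lt.2 (upper' y hy))
  have hxV : V < N x - f x := hx' (lower' x hx)
  have hζx : ∀ i, (I i).Nonempty → x < ζ i := fun i hi => by
    by_contra! h1
    linarith [upper x hx i hi h1]
  have hζy : ∀ i, (I i).Nonempty → ζ i < y := fun i hi => by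
    by_contra! h1
    linarith [lower y hy i hi h1]
  have hyI : ∀ i, y ∉ I i := fun i hi => by
    obtain ⟨hiI, hiz⟩ := hζ i ⟨y, hi⟩
    linarith [hstrict i _ hiI y hi (hζy i ⟨y, hi⟩)]
  have hxI : ∀ i, x ∉ I i := fun i hi => by
    obtain ⟨hiI, hiz⟩ := hζ i ⟨x, hi⟩
    linarith [hstrict i x hi _ hiI (hζx i ⟨x, hi⟩)]
  have hNb : N b = N y := realC_eq_of_forall_notMem_actI hw hy.1.le hy.2.le le_rfl
    fun i m hm h1 _ => hyI i <|
      hord i _ (hζ i ⟨m, hm⟩).1 _ hm _ (hζy i ⟨m, hm⟩).le h1.le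
  have hNa : N x = N a := realC_eq_of_forall_notMem_actI hw le_rfl hx.1.le hx.2.le
    fun i m hm _ h2 => hxI i <|
      hord i _ hm _ (hζ i ⟨m, hm⟩).1 _ h2.le (hζx i ⟨m, hm⟩).le
  have hfy := hfmono hy.2.le
  have hfx := hfmono hx.1.le
  have hsum := hlive (by linarith) (by linarith)
  have hle : (∑ i, if (I i).Nonempty then v i else 0) ≤ N b - N a := by
    rw [hN, realC_sub_eq_sum]
    refine Finset.sum_le_sum fun i _ => ?_
    split_ifs with hi
    · obtain ⟨⟨⟨z0, z1⟩, za, zb⟩, -⟩ := (hζ i hi).imp_left (mem_actI_iff hw).1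
      have hzx := mul_lt_mul_of_pos_left (hζx i hi) (hw i)
      have hzy := mul_lt_mul_of_pos_left (hζy i hi) (hw i)
      have hb := mul_lt_mul_of_pos_left hy.2 (hw i)
      have ha := mul_lt_mul_of_pos_left hx.1 (hw i)
      have h1 : 1 ≤ w i * y + θ i.castSucc := by
        by_contra! h1
        exact hyI i ((mem_actI_iff hw).2 ⟨⟨by linarith, h1⟩, hy⟩)
      have h0 : w i * x + θ i.castSucc ≤ 0 := by
        by_contra! h0
        exact hxI i ((mem_actI_iff hw).2 ⟨⟨h0, by linarith⟩, hx⟩)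
      rw [clipFn_of_one_le (by linarith), clipFn_of_nonpos (by linarith)]
      simp
    · exact mul_nonneg (hv i).le
        (sub_nonneg.2 (clipFn_affine_mono hw θ i (hz₀.1.trans hz₀.2).le))
  linarith

open Classical in
lemma riskC_le_of_critical {a b : ℝ} (hab : a < b) (hv : ∀ i, 0 < v i)
    (hw : ∀ i, 0 < w i) {f p : ℝ → ℝ} (hf : Continuous f) (hp : Continuous p)
    (hpos : ∀ x ∈ Set.Ioo a b, 0 < p x) (hfmono : Monotone f) {K : ℝ} (hK : ∀ i, K < v i * w i)
    (hLip : ∀ x ∈ Set.Icc a b, ∀ y ∈ Set.Icc a b, |f x - f y| ≤ K * |x - y|)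
    {θ : Fin (h + 1) → ℝ} {V : ℝ} (hV0 : 0 ≤ V)
    (hV : ∀ x ∈ Set.Ioo a b, ∑ i : Fin h, (actI a b w θ i).indicator (fun _ => v i) x ≤ V)
    (hgrad : gradC a b v w f p θ = 0)
    (hlive : realC v w θ b < f b → f a < realC v w θ a →
      f b - f a < ∑ i, if (actI a b w θ i).Nonempty then v i else 0) :
    riskC a b v w f p θ ≤ (2 * V ^ 2 + (f b - f a) * V) * ∫ x in Set.Ioo a b, p x := by
  have hNc := continuous_realC_right (v := v) (w := w) θ
  set N := realC v w θ with hN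
  have hg : Continuous fun x => N x - f x := hNc.sub hf
  have hInt := fun {q : ℝ → ℝ} (hq : Continuous q) => integrableOn_Ioo_of_continuous hq a b
  have h0 : ∫ x in Set.Ioo a b, (N x - f x) * p x = 0 := by
    have := gradC_last hv hw hf hp a b θ
    rw [hgrad] at this
    simpa using this
  have hgp : Continuous fun x => (N x - f x) * p x := hg.mul hp
  have hzero : ∃ z ∈ Set.Ioo a b, N z = f z := by
    obtain ⟨z, hz, hz0⟩ := exists_eq_zero_of_setIntegral_mul_eq_zero hg isOpen_Ioo
      Set.ordConnected_Ioo (Set.nonempty_Ioo.2 hab) hpos (hInt hgp) h0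
    exact ⟨z, hz, sub_eq_zero.1 hz0⟩
  have hzeros : ∀ i, (actI a b w θ i).Nonempty → ∃ z ∈ actI a b w θ i, N z = f z := fun i hi => by
    have hi0 := gradC_castSucc hv hw hf hp a b θ i
    rw [hgrad, Pi.zero_apply, eq_comm, mul_eq_zero,
      or_iff_right (mul_pos two_pos (hv i)).ne'] at hi0
    obtain ⟨z, hz, hz0⟩ := exists_eq_zero_of_setIntegral_mul_eq_zero hg (isOpen_actI a b w θ i)
      (ordConnected_actI a b w θ i) hi (fun x hx => hpos x hx.2)
      ((hInt hgp).mono_set Set.inter_subset_right) hi0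
    exact ⟨z, hz, sub_eq_zero.1 hz0⟩
  have hp0 : 0 ≤ ∫ x in Set.Ioo a b, p x :=
    setIntegral_nonneg measurableSet_Ioo fun x hx => (hpos x hx).le
  have key : ∀ c : ℝ, (∀ x ∈ Set.Ioo a b,
      (N x - f x) ^ 2 ≤ c * (N x - f x) + V * (V + (f b - f a))) →
      riskC a b v w f p θ ≤ (2 * V ^ 2 + (f b - f a) * V) * ∫ x in Set.Ioo a b, p x := by
    intro c hc
    calc riskC a b v w f p θ
        ≤ ∫ x in Set.Ioo a b, (c * ((N x - f x) * p x) + V * (V + (f b - f a)) * p x) := by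
          refine setIntegral_mono_on (hInt (by fun_prop)) (hInt (by fun_prop)) measurableSet_Ioo
            fun x hx => ?_
          have := mul_le_mul_of_nonneg_right (hc x hx) (hpos x hx).le
          linarith
      _ = V * (V + (f b - f a)) * ∫ x in Set.Ioo a b, p x := by
          rw [integral_add (hInt (by fun_prop)) (hInt (by fun_prop)), integral_const_mul,
            integral_const_mul, h0, mul_zero, zero_add]
      _ ≤ _ := mul_le_mul_of_nonneg_right (by nlinarith [sq_nonneg V]) hp0
  rcases realC_sub_bounds_of_critical hv hw hfmono hK hLip hV0 hV hzero hzeros hlive with hB | hB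
  · exact key (f b - f a) fun x hx => by
      nlinarith [mul_nonneg (sub_nonneg.2 (hB x hx).1) (sub_nonneg.2 (hB x hx).2)]
  · exact key (-(f b - f a)) fun x hx => by
      nlinarith [mul_nonneg (sub_nonneg.2 (hB x hx).1) (sub_nonneg.2 (hB x hx).2)]

end Structure

section Dynamics

lemma le_of_rightDeriv_ge {u u' : ℝ → ℝ} {c S T : ℝ} (hS : 0 ≤ S) (hST : S ≤ T)
    (hu : ContinuousOn u (Set.Ici 0))
    (hd : ∀ t, 0 ≤ t → HasDerivWithinAt u (u' t) (Set.Ici t) t)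
    (hc : ∀ t, S ≤ t → c ≤ u' t) : u S + c * (T - S) ≤ u T := by
  have hB : ∀ t : ℝ, HasDerivAt (fun t => -(u S + c * (t - S))) (-c) t := fun t =>
    ((((hasDerivAt_id t).sub_const S).const_mul c).const_add (u S)).neg.congr_deriv (by simp)
  have := image_le_of_deriv_right_le_deriv_boundary (f := fun t => -u t) (f' := fun t => -u' t)
    (a := S) (b := T) (B := fun t => -(u S + c * (t - S))) (B' := fun _ => -c)
    (hu.mono fun t ht => hS.trans ht.1).neg
    (fun t ht => (hd t (hS.trans ht.1)).neg) (by simp)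
    (fun t _ => (hB t).continuousAt.continuousWithinAt)
    (fun t _ => (hB t).hasDerivWithinAt) (fun t ht => neg_le_neg (hc t ht.1))
    (Set.right_mem_Icc.2 hST)
  linarith

lemma pos_of_rightDeriv_ge_neg_mul {u u' : ℝ → ℝ} {C T : ℝ} (hu : ContinuousOn u (Set.Ici 0))
    (hd : ∀ t, 0 ≤ t → HasDerivWithinAt u (u' t) (Set.Ici t) t) (h0 : 0 < u 0)
    (hC : ∀ t ∈ Set.Icc 0 T, 0 < u t → -C * u t ≤ u' t) : ∀ t ∈ Set.Icc 0 T, 0 < u t := by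
  intro t ht
  have hB : ∀ t : ℝ, HasDerivAt (fun t => -(u 0 / 2 * Real.exp (-(C + 1) * t)))
      (-(u 0 / 2 * (Real.exp (-(C + 1) * t) * (-(C + 1))))) t := fun t =>
    ((((hasDerivAt_id t).const_mul (-(C + 1))).exp.const_mul (u 0 / 2)).neg).congr_deriv (by simp)
  have hle := image_le_of_deriv_right_lt_deriv_boundary (f := fun t => -u t) (f' := fun t => -u' t)
    (a := 0) (b := T) (hu.mono fun t ht => ht.1).neg (fun t ht => (hd t ht.1).neg)
    (by simp; linarith) hB (fun s hs hsB => by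
      have he : 0 < u 0 / 2 * Real.exp (-(C + 1) * s) := by positivity
      have hsB' : u s = u 0 / 2 * Real.exp (-(C + 1) * s) := neg_injective hsB
      have := hC s ⟨hs.1, hs.2.le⟩ (by rw [hsB']; exact he)
      rw [hsB'] at this
      linarith) ht
  have he : 0 < u 0 / 2 * Real.exp (-(C + 1) * t) := by positivity
  linarith

lemma pos_of_tendsto_of_rightDeriv {u u' : ℝ → ℝ} {l : ℝ} (hu : ContinuousOn u (Set.Ici 0))
    (hd : ∀ t, 0 ≤ t → HasDerivWithinAt u (u' t) (Set.Ici t) t) (h0 : 0 < u 0)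
    (hC : ∀ T, ∃ C, ∀ t ∈ Set.Icc 0 T, 0 < u t → -C * u t ≤ u' t)
    (hl : Tendsto u atTop (nhds l)) (hev : l ≤ 0 → ∀ᶠ t in atTop, 0 ≤ u' t) : 0 < l := by
  by_contra! hl0
  obtain ⟨S, hS⟩ := eventually_atTop.1 ((hev hl0).and (eventually_ge_atTop 0))
  have hS0 : 0 ≤ S := (hS S le_rfl).2
  obtain ⟨C, hC⟩ := hC S
  have hSpos := pos_of_rightDeriv_ge_neg_mul hu hd h0 hC S ⟨hS0, le_rfl⟩
  refine absurd (ge_of_tendsto hl ?_) (not_le.2 (hl0.trans_lt hSpos))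
  filter_upwards [eventually_ge_atTop S] with t ht
  have := le_of_rightDeriv_ge hS0 ht hu hd (fun t ht => (hS t ht).1)
  linarith

lemma limit_rightDeriv_nonpos {u u' : ℝ → ℝ} {l L : ℝ} (hu : ContinuousOn u (Set.Ici 0))
    (hd : ∀ t, 0 ≤ t → HasDerivWithinAt u (u' t) (Set.Ici t) t)
    (hl : Tendsto u atTop (nhds l)) (hL : Tendsto u' atTop (nhds L)) : L ≤ 0 := by
  by_contra! hL0
  obtain ⟨S, hS⟩ := eventually_atTop.1
    ((hL.eventually (lt_mem_nhds (half_lt_self hL0))).and (eventually_ge_atTop 0))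
  have hS0 : 0 ≤ S := (hS S le_rfl).2
  have h1 : Tendsto (fun t => u S + L / 2 * (t - S)) atTop atTop :=
    tendsto_atTop_add_const_left _ _
      ((tendsto_atTop_add_const_right _ (-S) tendsto_id).const_mul_atTop (half_pos hL0))
  refine not_tendsto_nhds_of_tendsto_atTop (tendsto_atTop_mono' _ ?_ h1) l hl
  filter_upwards [eventually_ge_atTop S] with t ht
  exact le_of_rightDeriv_ge hS0 ht hu hd (fun t ht => (hS t ht).1.le)

lemma limit_rightDeriv_eq_zero {u u' : ℝ → ℝ} {l L : ℝ} (hu : ContinuousOn u (Set.Ici 0))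
    (hd : ∀ t, 0 ≤ t → HasDerivWithinAt u (u' t) (Set.Ici t) t)
    (hl : Tendsto u atTop (nhds l)) (hL : Tendsto u' atTop (nhds L)) : L = 0 :=
  le_antisymm (limit_rightDeriv_nonpos hu hd hl hL) <| by
    have := limit_rightDeriv_nonpos hu.neg (fun t ht => (hd t ht).neg) hl.neg hL.neg
    linarith

lemma tendsto_of_tendsto_euclNorm {n : ℕ} {Θ : ℝ → Fin n → ℝ} {ϑ : Fin n → ℝ}
    (hlim : Tendsto (fun t => euclNorm (Θ t - ϑ)) atTop (nhds 0)) :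
    Tendsto Θ atTop (nhds ϑ) := by
  refine tendsto_pi_nhds.2 fun k => tendsto_iff_dist_tendsto_zero.2 ?_
  refine squeeze_zero (fun _ => dist_nonneg) (fun t => ?_) hlim
  rw [Real.dist_eq, euclNorm]
  refine Real.abs_le_sqrt ?_
  exact Finset.single_le_sum (f := fun k => ((Θ t - ϑ) k) ^ 2) (fun _ _ => sq_nonneg _)
    (Finset.mem_univ k)

lemma hasDerivWithinAt_of_integral_eq {n : ℕ} {Θ : ℝ → Fin n → ℝ} {G : (Fin n → ℝ) → Fin n → ℝ}
    (hG : Continuous G) (hcont : ContinuousOn Θ (Set.Ici 0))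
    (hGF : ∀ t : ℝ, 0 ≤ t → Θ t = Θ 0 - ∫ s in Set.Icc (0 : ℝ) t, G (Θ s))
    {t : ℝ} (ht : 0 ≤ t) : HasDerivWithinAt Θ (-G (Θ t)) (Set.Ici t) t := by
  have hc : Continuous fun s : ℝ => G (Θ (max s 0)) :=
    hG.comp (hcont.comp_continuous (by fun_prop) fun s => le_max_right s 0)
  have h1 := ((intervalIntegral.integral_hasDerivAt_right (hc.intervalIntegrable 0 t)
    (hc.stronglyMeasurableAtFilter _ _) hc.continuousAt).const_sub (Θ 0)).hasDerivWithinAt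
    (s := Set.Ici t)
  rw [max_eq_left ht] at h1
  have heq : ∀ s, 0 ≤ s → Θ s = Θ 0 - ∫ r in (0 : ℝ)..s, G (Θ (max r 0)) := fun s hs => by
    rw [hGF s hs, intervalIntegral.integral_of_le hs, integral_Icc_eq_integral_Ioc]
    congr 1
    refine setIntegral_congr_fun measurableSet_Ioc fun r hr => ?_
    simp only [max_eq_left hr.1.le]
  exact h1.congr (fun s hs => heq s (ht.trans hs)) (heq t ht)

variable {h : ℕ} {v w : Fin h → ℝ}

lemma actI_nonempty {a b : ℝ} (hab : a < b) (hw : ∀ i, 0 < w i) {θ : Fin (h + 1) → ℝ} {i : Fin h}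
    (hb : 0 < w i * b + θ i.castSucc) (ha : 0 < 1 - (w i * a + θ i.castSucc)) :
    (actI a b w θ i).Nonempty := by
  have hlt := mul_lt_mul_of_pos_left hab (hw i)
  by_contra hne
  have := exists_mem_actI_of_clipFn_ne (θ := θ) (i := i) hw le_rfl hab.le le_rfl
  refine absurd (this fun hc => ?_) fun ⟨m, hm, _⟩ => hne ⟨m, hm⟩
  have h1 : clipFn (w i * a + θ i.castSucc) < clipFn (w i * b + θ i.castSucc) := by
    unfold clipFn
    have h2 : max (w i * a + θ i.castSucc) 0 < w i * b + θ i.castSucc := max_lt (by linarith) hb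
    rw [min_eq_left (max_le (by linarith) zero_le_one)]
    exact lt_min (h2.trans_le (le_max_left _ _)) (max_lt (by linarith) zero_lt_one)
  exact h1.ne' hc

lemma abs_gradC_castSucc_le {a b : ℝ} (hv : ∀ i, 0 < v i) (hw : ∀ i, 0 < w i) {f p : ℝ → ℝ}
    (hf : Continuous f) (hp : Continuous p) {θ : Fin (h + 1) → ℝ} {i : Fin h} {M c d : ℝ}
    (hM : ∀ x ∈ Set.Icc a b, |(realC v w θ x - f x) * p x| ≤ M) (hM0 : 0 ≤ M) (hcd : c ≤ d)
    (hsub : actI a b w θ i ⊆ Set.Ioo c d) :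
    |gradC a b v w f p θ i.castSucc| ≤ 2 * v i * M * (d - c) := by
  have hvol : volume (actI a b w θ i) ≤ ENNReal.ofReal (d - c) := by
    rw [← Real.volume_Ioo]; exact measure_mono hsub
  have hb := norm_setIntegral_le_of_norm_le_const (μ := volume)
    (f := fun x => (realC v w θ x - f x) * p x) (hvol.trans_lt ENNReal.ofReal_lt_top)
    (fun x hx => hM x ⟨hx.2.1.le, hx.2.2.le⟩)
  have hr : volume.real (actI a b w θ i) ≤ d - c := by
    refine (ENNReal.toReal_mono ENNReal.ofReal_ne_top hvol).trans_eq ?_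
    rw [ENNReal.toReal_ofReal (sub_nonneg.2 hcd)]
  rw [gradC_castSucc hv hw hf hp, abs_mul, abs_of_pos (mul_pos two_pos (hv i)), mul_assoc (2 * v i)]
  have := hv i
  refine mul_le_mul_of_nonneg_left ?_ (by positivity)
  exact hb.trans (mul_le_mul_of_nonneg_left hr hM0)

lemma exists_bound_along_curve {f p : ℝ → ℝ} (hf : Continuous f) (hp : Continuous p)
    {Θ : ℝ → Fin (h + 1) → ℝ} (hcont : ContinuousOn Θ (Set.Ici 0)) (a b T : ℝ) :
    ∃ M, 0 ≤ M ∧ ∀ t ∈ Set.Icc 0 T, ∀ x ∈ Set.Icc a b,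
      |(realC v w (Θ t) x - f x) * p x| ≤ M := by
  have hc : ContinuousOn (fun q : ℝ × ℝ => (realC v w (Θ q.1) q.2 - f q.2) * p q.2)
      (Set.Icc 0 T ×ˢ Set.Icc a b) := by
    refine ContinuousOn.mul (ContinuousOn.sub ?_ (by fun_prop)) (by fun_prop)
    exact continuous_realC.comp_continuousOn
      ((hcont.comp continuousOn_fst fun q hq => hq.1.1).prodMk continuousOn_snd)
  obtain ⟨M, hM⟩ := (isCompact_Icc.prod isCompact_Icc).exists_bound_of_continuousOn hc
  exact ⟨max M 0, le_max_right _ _, fun t ht x hx => (hM (t, x) ⟨ht, hx⟩).trans (le_max_left _ _)⟩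

/-- A strict inequality between the limit realization and the target at a point persists, uniformly
near this point, along a convergent curve. -/
lemma exists_eventually_forall_dist_lt {f : ℝ → ℝ} {Θ : ℝ → Fin (h + 1) → ℝ}
    {ϑ : Fin (h + 1) → ℝ} (hΘ : Tendsto Θ atTop (nhds ϑ)) {c : ℝ} {P : ℝ → Prop}
    (hf : Continuous f) (hP : ∀ᶠ y in nhds (realC v w ϑ c - f c), P y) :
    ∃ δ > 0, ∀ᶠ t in atTop, ∀ x, |x - c| < δ → P (realC v w (Θ t) x - f x) := by
  have hc : Continuous fun q : (Fin (h + 1) → ℝ) × ℝ => realC v w q.1 q.2 - f q.2 :=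
    continuous_realC.sub (hf.comp continuous_snd)
  have h1 := (hc.tendsto (ϑ, c)).eventually hP
  rw [nhds_prod_eq, eventually_prod_iff] at h1
  obtain ⟨pa, hpa, pb, hpb, hab⟩ := h1
  obtain ⟨δ, hδ, hpb⟩ := Metric.eventually_nhds_iff.1 hpb
  exact ⟨δ, hδ, (hΘ.eventually hpa).mono fun t ht x hx => hab ht (hpb hx)⟩

/-- Neurons that are active initially stay active in the limit provided that the limit realization
lies strictly inside the range of the target. -/
lemma actI_nonempty_of_gradientFlow {a b : ℝ} (hab : a < b) (hv : ∀ i, 0 < v i)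
    (hw : ∀ i, 0 < w i) {f p : ℝ → ℝ} (hf : Continuous f) (hp : Continuous p)
    (hpnn : ∀ x, 0 ≤ p x) {Θ : ℝ → Fin (h + 1) → ℝ} (hcont : ContinuousOn Θ (Set.Ici 0))
    (hd : ∀ t, 0 ≤ t → HasDerivWithinAt Θ (-gradC a b v w f p (Θ t)) (Set.Ici t) t)
    {ϑ : Fin (h + 1) → ℝ} (hΘ : Tendsto Θ atTop (nhds ϑ))
    (hNb : realC v w ϑ b < f b) (hNa : f a < realC v w ϑ a) {i : Fin h}
    (hi : psiC w (Θ 0) i ∈ Set.Ioo (a - (w i)⁻¹) b) :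
    (actI a b w ϑ i).Nonempty := by
  have hwi := hw i
  have hvi := hv i
  have hci : ContinuousOn (fun t => Θ t i.castSucc) (Set.Ici 0) :=
    (continuous_apply i.castSucc).comp_continuousOn hcont
  have hdi : ∀ t, 0 ≤ t → HasDerivWithinAt (fun t => Θ t i.castSucc)
      (-gradC a b v w f p (Θ t) i.castSucc) (Set.Ici t) t := fun t ht =>
    hasDerivWithinAt_pi.1 (hd t ht) i.castSucc
  have hli : Tendsto (fun t => Θ t i.castSucc) atTop (nhds (ϑ i.castSucc)) :=
    tendsto_pi_nhds.1 hΘ i.castSucc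
  obtain ⟨hi1, hi2⟩ := hi
  rw [psiC, ← one_div, sub_lt_iff_lt_add, ← add_div, lt_div_iff₀ hwi] at hi1
  rw [psiC, div_lt_iff₀ hwi] at hi2
  have hm : ∀ t, MeasurableSet (actI a b w (Θ t) i) := fun t => (isOpen_actI _ _ _ _ _).measurableSet
  refine actI_nonempty hab hw ?_ ?_
  · refine pos_of_tendsto_of_rightDeriv (u := fun t => w i * b + Θ t i.castSucc)
      (continuousOn_const.add hci) (fun t ht => (hdi t ht).const_add _) (by linarith) (fun T => ?_)
      (hli.const_add _) (fun hl => ?_)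
    · obtain ⟨M, hM0, hM⟩ := exists_bound_along_curve (v := v) (w := w) hf hp hcont a b T
      refine ⟨2 * v i * M / w i, fun t ht hu => ?_⟩
      have := abs_gradC_castSucc_le hv hw hf hp (hM t ht) hM0 (i := i)
        (c := b - (w i * b + Θ t i.castSucc) / w i) (d := b)
        (by have := div_pos hu hwi; linarith) fun x hx => by
          obtain ⟨⟨h1, -⟩, -, hxb⟩ := (mem_actI_iff hw).1 hx
          refine ⟨?_, hxb⟩
          rw [sub_lt_comm, lt_div_iff₀ hwi]
          linarith
      have h2 := (le_abs_self _).trans this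
      have e : 2 * v i * M * (b - (b - (w i * b + Θ t i.castSucc) / w i)) =
          2 * v i * M / w i * (w i * b + Θ t i.castSucc) := by ring
      rw [e] at h2
      linarith
    · obtain ⟨δ, hδ, hev⟩ := exists_eventually_forall_dist_lt hΘ hf
        (gt_mem_nhds (sub_neg.2 hNb) : ∀ᶠ y in nhds (realC v w ϑ b - f b), y < 0)
      have hs : ∀ᶠ t in atTop, w i * b + Θ t i.castSucc < w i * δ :=
        (hli.const_add _).eventually (gt_mem_nhds (hl.trans_lt (mul_pos hwi hδ)))
      filter_upwards [hev, hs] with t ht1 ht2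
      rw [gradC_castSucc hv hw hf hp, neg_nonneg]
      refine mul_nonpos_of_nonneg_of_nonpos (by positivity)
        (setIntegral_nonpos (hm t) fun x hx => ?_)
      obtain ⟨⟨h1, -⟩, -, hxb⟩ := (mem_actI_iff hw).1 hx
      refine mul_nonpos_of_nonpos_of_nonneg (ht1 x ?_).le (hpnn x)
      rw [abs_sub_comm, abs_of_pos (sub_pos.2 hxb)]
      refine lt_of_mul_lt_mul_left ?_ hwi.le
      linarith
  · refine pos_of_tendsto_of_rightDeriv (u := fun t => 1 - (w i * a + Θ t i.castSucc))
      (continuousOn_const.sub (continuousOn_const.add hci))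
      (fun t ht => ((hdi t ht).const_add _).const_sub _) (by linarith) (fun T => ?_)
      ((hli.const_add _).const_sub _) (fun hl => ?_)
    · obtain ⟨M, hM0, hM⟩ := exists_bound_along_curve (v := v) (w := w) hf hp hcont a b T
      refine ⟨2 * v i * M / w i, fun t ht hu => ?_⟩
      have := abs_gradC_castSucc_le hv hw hf hp (hM t ht) hM0 (i := i)
        (c := a) (d := a + (1 - (w i * a + Θ t i.castSucc)) / w i)
        (by have := div_pos hu hwi; linarith) fun x hx => by
          obtain ⟨⟨-, h1⟩, hxa, -⟩ := (mem_actI_iff hw).1 hx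
          refine ⟨hxa, ?_⟩
          rw [← sub_lt_iff_lt_add', lt_div_iff₀ hwi]
          linarith
      have h2 := (neg_abs_le _).trans' (neg_le_neg this)
      have e : 2 * v i * M * (a + (1 - (w i * a + Θ t i.castSucc)) / w i - a) =
          2 * v i * M / w i * (1 - (w i * a + Θ t i.castSucc)) := by ring
      rw [e] at h2
      linarith
    · obtain ⟨δ, hδ, hev⟩ := exists_eventually_forall_dist_lt hΘ hf
        (lt_mem_nhds (sub_pos.2 hNa) : ∀ᶠ y in nhds (realC v w ϑ a - f a), 0 < y)
      have hs : ∀ᶠ t in atTop, 1 - (w i * a + Θ t i.castSucc) < w i * δ :=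
        ((hli.const_add _).const_sub _).eventually (gt_mem_nhds (hl.trans_lt (mul_pos hwi hδ)))
      filter_upwards [hev, hs] with t ht1 ht2
      rw [gradC_castSucc hv hw hf hp, neg_neg]
      refine mul_nonneg (by positivity) (setIntegral_nonneg (hm t) fun x hx => ?_)
      obtain ⟨⟨-, h1⟩, hxa, -⟩ := (mem_actI_iff hw).1 hx
      refine mul_nonneg (ht1 x ?_).le (hpnn x)
      rw [abs_of_pos (sub_pos.2 hxa)]
      refine lt_of_mul_lt_mul_left ?_ hwi.le
      linarith

end Dynamics

theorem statement_14
    (a b : ℝ) (hab : a < b) (h : ℕ) (hh : 0 < h)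
    (v w : Fin h → ℝ) (hv : ∀ i, 0 < v i) (hw : ∀ i, 0 < w i)
    (f p : ℝ → ℝ) (hf : Continuous f) (hp : Continuous p)
    (hpnn : ∀ x : ℝ, 0 ≤ p x) (hsupp : {x : ℝ | 0 < p x} = Set.Ioo a b)
    (hfmono : Monotone f)
    -- `Lip(f) < min_i v_i w_i`
    (K : ℝ) (hK : ∀ i, K < v i * w i)
    (hLipf : ∀ x ∈ Set.Icc a b, ∀ y ∈ Set.Icc a b, |f x - f y| ≤ K * |x - y|)
    (Θ : ℝ → Fin (h + 1) → ℝ)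
    (hcont : ContinuousOn Θ (Set.Ici 0))
    (hGF : ∀ t : ℝ, 0 ≤ t →
      Θ t = Θ 0 - ∫ s in Set.Icc (0 : ℝ) t, gradC a b v w f p (Θ s))
    (ϑ : Fin (h + 1) → ℝ)
    (hlim : Filter.Tendsto (fun t => euclNorm (Θ t - ϑ)) Filter.atTop (nhds 0))
    (V : ℝ)
    (hV : V = sSup ((fun x => ∑ i : Fin h, (actI a b w ϑ i).indicator (fun _ => v i) x) ''
      Set.Ioo a b))
    (hVsmall : V < (∫ x in Set.Ioo a b, p x)⁻¹ *
      min (∫ x in Set.Ioo a b, (f b - f x) * p x) (∫ x in Set.Ioo a b, (f x - f a) * p x))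
    (hbig : f b - f a + 4 * V <
      ∑ i : Fin h, (Set.Ioo (a - (w i)⁻¹) b).indicator (fun _ => v i) (psiC w (Θ 0) i)) :
    riskC a b v w f p ϑ ≤ (2 * V ^ 2 + (f b - f a) * V) * ∫ x in Set.Ioo a b, p x := by
  classical
  have hG := continuous_gradC hv hw hf hp a b
  have hΘ := tendsto_of_tendsto_euclNorm hlim
  have hd := fun t (ht : 0 ≤ t) => hasDerivWithinAt_of_integral_eq hG hcont hGF ht
  have hgrad : gradC a b v w f p ϑ = 0 := by
    funext k
    have := limit_rightDeriv_eq_zero ((continuous_apply k).comp_continuousOn hcont)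
      (fun t ht => hasDerivWithinAt_pi.1 (hd t ht) k) (tendsto_pi_nhds.1 hΘ k)
      (tendsto_pi_nhds.1 ((hG.tendsto ϑ).comp hΘ).neg k)
    simpa using this
  have hind : ∀ i x, 0 ≤ (actI a b w ϑ i).indicator (fun _ => v i) x := fun i x =>
    Set.indicator_nonneg (fun _ _ => (hv i).le) x
  have hVle : ∀ x ∈ Set.Ioo a b,
      ∑ i : Fin h, (actI a b w ϑ i).indicator (fun _ => v i) x ≤ V := fun x hx => by
    rw [hV]
    refine le_csSup ⟨∑ i, v i, ?_⟩ (Set.mem_image_of_mem _ hx)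
    rintro _ ⟨y, -, rfl⟩
    exact Finset.sum_le_sum fun i _ => Set.indicator_le_self' (fun _ _ => (hv i).le) y
  have hV0 : 0 ≤ V := by
    obtain ⟨x, hx⟩ := Set.nonempty_Ioo.2 hab
    exact (Finset.sum_nonneg fun i _ => hind i x).trans (hVle x hx)
  refine riskC_le_of_critical hab hv hw hf hp (fun x hx => hsupp.ge hx) hfmono hK hLipf hV0 hVle
    hgrad fun hNb hNa => ?_
  refine (lt_of_le_of_lt (by linarith) hbig).trans_le (Finset.sum_le_sum fun i _ => ?_)
  by_cases hi : psiC w (Θ 0) i ∈ Set.Ioo (a - (w i)⁻¹) b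
  · rw [if_pos (actI_nonempty_of_gradientFlow hab hv hw hf hp hpnn hcont hd hΘ hNb hNa hi)]
    exact Set.indicator_le_self' (fun _ _ => (hv i).le) _
  · rw [Set.indicator_of_notMem hi]
    split_ifs
    exacts [(hv i).le, le_rfl]
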